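/- arXiv:2503.16195 — 2 statements merged into one kernel-verified Lean document; each statement's English description precedes it below -/
import Mathlib

section
/- Gaussian privacy-loss probability: let a, b ∈ ℝ^n with a ≠ b, set Δ = ‖a − b‖₂, let σ > 0, and let μ_a be the Gaussian measure on ℝ^n with mean a and covariance σ² I. Then for every ε > 0, μ_a({x : (‖x − b‖² − ‖x − a‖²)/(2σ²) > ε}) = P(Z > σε/Δ − Δ/(2σ)), where Z is a standard one-dimensional Gaussian random variable. -/
open MeasureTheory ProbabilityTheory
open scoped BigOperators

/-- A linear combination of independent real Gaussian coordinates is Gaussian. -/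
theorem map_sum_mul_pi_gaussianReal {ι : Type*} [Fintype ι] (c m : ι → ℝ) (v : ι → NNReal) :
    (Measure.pi fun i => gaussianReal (m i) (v i)).map (fun x => ∑ i, c i * x i)
      = gaussianReal (∑ i, c i * m i) (∑ i, ‖c i‖₊ ^ 2 * v i) := by
  have hmeas : Measurable fun x : ι → ℝ => ∑ i, c i * x i := by fun_prop
  have := Measure.isProbabilityMeasure_map
    (μ := Measure.pi fun i => gaussianReal (m i) (v i)) hmeas.aemeasurable
  refine Measure.ext_of_charFun ?_
  ext t
  rw [charFun_apply_real, integral_map hmeas.aemeasurable (by fun_prop), charFun_gaussianReal]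
  have hprod : ∀ x : ι → ℝ, Complex.exp (t * ((∑ i, c i * x i : ℝ) : ℂ) * Complex.I)
      = ∏ i, Complex.exp (((t * c i : ℝ) : ℂ) * x i * Complex.I) := by
    intro x
    rw [← Complex.exp_sum]
    push_cast
    rw [Finset.mul_sum, Finset.sum_mul]
    simp only [mul_assoc]
  simp_rw [hprod]
  rw [integral_fintype_prod_eq_prod
    (f := fun i (y : ℝ) => Complex.exp (((t * c i : ℝ) : ℂ) * y * Complex.I))]
  simp_rw [← charFun_apply_real, charFun_gaussianReal]
  rw [← Complex.exp_sum]
  have hsq : ∀ i, ((‖c i‖ : ℝ) : ℂ) ^ 2 = (c i : ℂ) ^ 2 := fun i => by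
    rw [← Complex.ofReal_pow, Real.norm_eq_abs, sq_abs, Complex.ofReal_pow]
  push_cast
  simp only [hsq]
  rw [Finset.sum_sub_distrib, Finset.mul_sum, Finset.sum_mul, Finset.sum_mul, Finset.sum_div]
  congr 2 <;> refine Finset.sum_congr rfl fun i _ => ?_ <;> ring

/-- The difference of the squared distances to `b` and to `a` is affine. -/
theorem sum_sub_sq_sub_sum_sub_sq {ι : Type*} [Fintype ι] (a b x : ι → ℝ) :
    (∑ i, (x i - b i) ^ 2) - ∑ i, (x i - a i) ^ 2
      = 2 * ((∑ i, (a i - b i) * x i) - ∑ i, (a i - b i) * a i) + ∑ i, (a i - b i) ^ 2 := by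
  rw [← Finset.sum_sub_distrib, ← Finset.sum_sub_distrib, Finset.mul_sum,
    ← Finset.sum_add_distrib]
  exact Finset.sum_congr rfl fun i _ => by ring

/-- Gaussian privacy-loss probability: for `a ≠ b` in `ℝⁿ` with `Δ = ‖a - b‖₂` and `σ > 0`,
the Gaussian measure (mean `a`, covariance `σ² I`) of the set where the privacy loss
`(‖x - b‖² - ‖x - a‖²)/(2σ²)` exceeds `ε` equals `P(Z > σε/Δ - Δ/(2σ))` for a standard
one-dimensional Gaussian `Z`. -/
theorem gaussian_privacy_loss_probability (n : ℕ) (a b : Fin n → ℝ) (hab : a ≠ b)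
    (σ : ℝ) (hσ : 0 < σ) (ε : ℝ) (hε : 0 < ε)
    (Δ : ℝ) (hΔ : Δ = Real.sqrt (∑ i : Fin n, (a i - b i) ^ 2)) :
    (Measure.pi fun i => gaussianReal (a i) (Real.toNNReal (σ ^ 2)))
        {x : Fin n → ℝ |
          ε < ((∑ i : Fin n, (x i - b i) ^ 2) - ∑ i : Fin n, (x i - a i) ^ 2) / (2 * σ ^ 2)}
      = gaussianReal 0 1 {z : ℝ | σ * ε / Δ - Δ / (2 * σ) < z} := by
  have hpos : 0 < ∑ i, (a i - b i) ^ 2 := by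
    obtain ⟨i, hi⟩ := Function.ne_iff.mp hab
    exact Finset.sum_pos' (fun j _ => sq_nonneg _)
      ⟨i, Finset.mem_univ i, sq_pos_of_ne_zero (sub_ne_zero.mpr hi)⟩
  have hΔ0 : 0 < Δ := hΔ ▸ Real.sqrt_pos.mpr hpos
  have hΔsq : ∑ i, (a i - b i) ^ 2 = Δ ^ 2 := by rw [hΔ, Real.sq_sqrt hpos.le]
  set c : Fin n → ℝ := fun i => (σ * Δ)⁻¹ * (a i - b i) with hc
  have hcsum : ∀ y : Fin n → ℝ, ∑ i, c i * y i = (σ * Δ)⁻¹ * ∑ i, (a i - b i) * y i := by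
    intro y
    simp only [hc, Finset.mul_sum, mul_assoc]
  have hvar : ∑ i, ‖c i‖₊ ^ 2 * Real.toNNReal (σ ^ 2) = 1 := by
    rw [← NNReal.coe_inj]
    push_cast
    simp only [Real.norm_eq_abs, sq_abs, Real.coe_toNNReal _ (sq_nonneg σ), hc, mul_pow]
    rw [← Finset.sum_mul, ← Finset.mul_sum, hΔsq]
    field_simp
  have hlaw : (Measure.pi fun i => gaussianReal (a i) (Real.toNNReal (σ ^ 2))).map
      (fun x => (∑ i, c i * x i) - ∑ i, c i * a i) = gaussianReal 0 1 := by
    have h := map_sum_mul_pi_gaussianReal c a fun _ => Real.toNNReal (σ ^ 2)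
    rw [hvar] at h
    rw [← sub_self (∑ i, c i * a i), ← gaussianReal_map_sub_const, ← h,
      Measure.map_map (by fun_prop) (by fun_prop), Function.comp_def]
  rw [← hlaw, Measure.map_apply (by fun_prop) (by exact measurableSet_Ioi)]
  congr 1
  ext x
  simp only [Set.mem_ofPred_eq, Set.mem_preimage]
  rw [hcsum, hcsum, ← mul_sub, sum_sub_sq_sub_sum_sub_sq, hΔsq]
  generalize (∑ i, (a i - b i) * x i) - ∑ i, (a i - b i) * a i = s
  have hscale : (σ * Δ)⁻¹ * s - (σ * ε / Δ - Δ / (2 * σ))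
      = σ / Δ * ((2 * s + Δ ^ 2) / (2 * σ ^ 2) - ε) := by
    field_simp
    ring
  rw [← sub_pos, ← sub_pos (b := σ * ε / Δ - Δ / (2 * σ)), hscale,
    mul_pos_iff_of_pos_left (div_pos hσ hΔ0)]
end

section
/- Gaussian mechanism indistinguishability (Dwork–Roth): let ε ∈ (0,1), δ ∈ (0,1), Δ > 0, and σ ≥ Δ · √(2 ln(1.25/δ)) / ε. Let a, b ∈ ℝ^n with ‖a − b‖₂ ≤ Δ, and let μ_a, μ_b be the Gaussian measures on ℝ^n with means a, b and covariance σ² I. Then for every measurable set S ⊆ ℝ^n, μ_a(S) ≤ e^ε · μ_b(S) + δ. -/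
open MeasureTheory ProbabilityTheory
open scoped BigOperators

open scoped ENNReal NNReal

theorem lintegral_pi_fin_prod {n : ℕ} {α : Fin n → Type*} [∀ i, MeasurableSpace (α i)]
    (μ : ∀ i, Measure (α i)) [∀ i, SigmaFinite (μ i)] {f : ∀ i, α i → ℝ≥0∞}
    (hf : ∀ i, Measurable (f i)) :
    ∫⁻ x, ∏ i, f i (x i) ∂Measure.pi μ = ∏ i, ∫⁻ y, f i y ∂μ i := by
  induction n with
  | zero => simp
  | succ n ih =>
    have hmp := (measurePreserving_piFinSuccAbove μ 0).symm
    calc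
      _ = ∫⁻ z : α 0 × (∀ i : Fin n, α i.succ), f 0 z.1 * ∏ i : Fin n, f i.succ (z.2 i)
            ∂(μ 0).prod (Measure.pi fun i : Fin n => μ i.succ) := by
          rw [← hmp.lintegral_comp (by fun_prop)]
          simp_rw [Fin.prod_univ_succ]
          rfl
      _ = (∫⁻ y, f 0 y ∂μ 0) * ∏ i : Fin n, ∫⁻ y, f i.succ y ∂μ i.succ := by
          rw [← ih _ fun i => hf i.succ]
          have hg : Measurable fun y : ∀ i : Fin n, α i.succ => ∏ i : Fin n, f i.succ (y i) := by
            fun_prop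
          exact lintegral_prod_mul (hf 0).aemeasurable hg.aemeasurable
      _ = _ := (Fin.prod_univ_succ fun i => ∫⁻ y, f i y ∂μ i).symm

theorem pi_withDensity_fin {n : ℕ} {α : Fin n → Type*} [∀ i, MeasurableSpace (α i)]
    (μ : ∀ i, Measure (α i)) [∀ i, SigmaFinite (μ i)] {f : ∀ i, α i → ℝ≥0∞}
    (hf : ∀ i, Measurable (f i)) [∀ i, SigmaFinite ((μ i).withDensity (f i))] :
    Measure.pi (fun i => (μ i).withDensity (f i)) =
      (Measure.pi μ).withDensity fun x => ∏ i, f i (x i) := by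
  refine Measure.pi_eq fun s hs => ?_
  rw [withDensity_apply _ (MeasurableSet.univ_pi hs), Measure.restrict_pi_pi,
    lintegral_pi_fin_prod _ hf]
  exact Finset.prod_congr rfl fun i _ => (withDensity_apply _ (hs i)).symm

theorem pi_gaussianReal_eq_withDensity {n : ℕ} (m : Fin n → ℝ) {v : ℝ≥0} (hv : v ≠ 0) :
    Measure.pi (fun i => gaussianReal (m i) v) =
      (volume : Measure (Fin n → ℝ)).withDensity
        fun x => ENNReal.ofReal (∏ i, gaussianPDFReal (m i) v (x i)) := by
  have h (i) : SigmaFinite ((volume : Measure ℝ).withDensity (gaussianPDF (m i) v)) := by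
    rw [← gaussianReal_of_var_ne_zero _ hv]
    infer_instance
  simp_rw [gaussianReal_of_var_ne_zero _ hv,
    ENNReal.ofReal_prod_of_nonneg fun i _ => gaussianPDFReal_nonneg (m i) v _]
  exact pi_withDensity_fin _ fun i => measurable_gaussianPDF (m i) v

theorem prod_gaussianPDFReal {n : ℕ} (m : Fin n → ℝ) (v : ℝ≥0) (x : Fin n → ℝ) :
    ∏ i, gaussianPDFReal (m i) v (x i) =
      (√(2 * Real.pi * v))⁻¹ ^ n * Real.exp (-(∑ i, (x i - m i) ^ 2) / (2 * v)) := by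
  simp_rw [gaussianPDFReal_def, Finset.prod_mul_distrib, ← Real.exp_sum, ← Finset.sum_div,
    Finset.sum_neg_distrib]
  simp

/-- If `exp u ≤ 1 + K exp ((1 + t) u)` for all `u`, then the Gaussian measure with mean `a` is
dominated by `exp ε` times the one with mean `b`, plus a multiple of the one with mean
`a + t (a - b)`, to which `p_a ^ (1 + t) * p_b ^ (-t)` is proportional. -/
theorem pi_gaussianReal_le_add {n : ℕ} (a b : Fin n → ℝ) {v : ℝ≥0} (hv : v ≠ 0) (ε : ℝ)
    {t K : ℝ} (hK0 : 0 ≤ K) (hK : ∀ u : ℝ, Real.exp u ≤ 1 + K * Real.exp ((1 + t) * u)) :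
    Measure.pi (fun i => gaussianReal (a i) v) ≤
      ENNReal.ofReal (Real.exp ε) • Measure.pi (fun i => gaussianReal (b i) v) +
      ENNReal.ofReal (K * Real.exp (-t * ε + t * (1 + t) / 2 * ((∑ i, (a i - b i) ^ 2) / v))) •
        Measure.pi (fun i => gaussianReal (a i + t * (a i - b i)) v) := by
  have hm (m : Fin n → ℝ) : Measurable fun x : Fin n → ℝ =>
      ENNReal.ofReal (∏ i, gaussianPDFReal (m i) v (x i)) := by
    have (i : Fin n) := measurable_gaussianPDFReal (m i) v
    fun_prop
  simp_rw [pi_gaussianReal_eq_withDensity _ hv]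
  rw [← withDensity_smul _ (hm _), ← withDensity_smul _ (hm _),
    ← withDensity_add_left ((hm _).const_smul _)]
  refine withDensity_mono (ae_of_all _ fun x => ?_)
  simp only [Pi.add_apply, Pi.smul_apply, smul_eq_mul]
  have hp (m : Fin n → ℝ) : 0 ≤ ∏ i, gaussianPDFReal (m i) v (x i) :=
    Finset.prod_nonneg fun i _ => gaussianPDFReal_nonneg _ _ _
  rw [← ENNReal.ofReal_mul (by positivity), ← ENNReal.ofReal_mul (by positivity),
    ← ENNReal.ofReal_add (mul_nonneg (by positivity) (hp _)) (mul_nonneg (by positivity) (hp _))]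
  refine ENNReal.ofReal_le_ofReal ?_
  simp_rw [prod_gaussianPDFReal]
  set A := -(∑ i, (x i - a i) ^ 2) / (2 * (v : ℝ)) with hA
  set B := -(∑ i, (x i - b i) ^ 2) / (2 * (v : ℝ)) with hB
  set C := -(∑ i, (x i - (a i + t * (a i - b i))) ^ 2) / (2 * (v : ℝ)) with hC
  set D := (∑ i, (a i - b i) ^ 2) / (v : ℝ) with hD
  have hv' : (v : ℝ) ≠ 0 := by exact_mod_cast hv
  have hsum : ∑ i, (x i - (a i + t * (a i - b i))) ^ 2 =
      (1 + t) * ∑ i, (x i - a i) ^ 2 - t * ∑ i, (x i - b i) ^ 2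
        + t * (1 + t) * ∑ i, (a i - b i) ^ 2 := by
    simp_rw [Finset.mul_sum, ← Finset.sum_sub_distrib, ← Finset.sum_add_distrib]
    exact Finset.sum_congr rfl fun i _ => by ring
  have hexp : (1 + t) * A - t * B = C + t * (1 + t) / 2 * D := by
    rw [hA, hB, hC, hD, hsum]
    field_simp
    ring
  clear_value A B C D
  have key : Real.exp A ≤ Real.exp ε * Real.exp B +
      K * Real.exp (-t * ε + t * (1 + t) / 2 * D) * Real.exp C := by
    have h := mul_le_mul_of_nonneg_left (hK (A - B - ε)) (Real.exp_pos (ε + B)).le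
    rw [mul_add, mul_one, mul_left_comm, ← Real.exp_add, ← Real.exp_add] at h
    rw [mul_assoc, ← Real.exp_add, ← Real.exp_add]
    have h1 : ε + B + (A - B - ε) = A := by ring
    have h2 : ε + B + (1 + t) * (A - B - ε) = -t * ε + t * (1 + t) / 2 * D + C := by
      linear_combination hexp
    rwa [h1, h2] at h
  have := mul_le_mul_of_nonneg_left key (by positivity : 0 ≤ (√(2 * Real.pi * v))⁻¹ ^ n)
  linarith

theorem exp_le_one_add_exp_two_mul (u : ℝ) :
    Real.exp u ≤ 1 + 1 / 4 * Real.exp ((1 + 1) * u) := by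
  rw [add_mul, one_mul, Real.exp_add]
  nlinarith [sq_nonneg (Real.exp u - 2)]

theorem exp_le_one_add_inv_mul_exp {t : ℝ} (ht : 0 ≤ t) (u : ℝ) :
    Real.exp u ≤ 1 + 1 / (1 + t) * Real.exp ((1 + t) * u) := by
  have h : (1 + t) * Real.exp u ≤ t + Real.exp ((1 + t) * u) := by
    have := one_add_mul_self_le_rpow_one_add
      (by linarith [Real.exp_pos u] : -1 ≤ Real.exp u - 1) (by linarith : 1 ≤ 1 + t)
    rw [add_sub_cancel, ← Real.exp_mul, mul_comm u] at this
    linarith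
  have h1 : 0 < 1 + t := by linarith
  rw [← mul_le_mul_iff_right₀ h1]
  field_simp
  linarith

/-- The Chernoff parameter `t` and prefactor `K` that make the additive error at most
`5 / 4 * exp (-w / 2)`. -/
theorem exists_chernoff_parameters {ε w : ℝ} (hε0 : 0 < ε) (hε1 : ε < 1) (hw : 0.44 ≤ w) :
    ∃ t K : ℝ, 0 ≤ t ∧ 0 ≤ K ∧ (∀ u : ℝ, Real.exp u ≤ 1 + K * Real.exp ((1 + t) * u)) ∧
      K * Real.exp (-t * ε + t * (1 + t) / 2 * (ε ^ 2 / w)) ≤ 5 / 4 * Real.exp (-(w / 2)) := by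
  have hw0 : 0 < w := by linarith
  rcases le_total w 1 with hw1 | hw1
  · refine ⟨1, 1 / 4, zero_le_one, by norm_num, exp_le_one_add_exp_two_mul, ?_⟩
    have h5 : Real.exp 1.6 ≤ 5 := by
      refine le_of_pow_le_pow_left₀ (n := 5) (by norm_num) (by norm_num) ?_
      rw [← Real.exp_nat_mul]
      calc Real.exp ((5 : ℕ) * 1.6) = Real.exp 1 ^ 8 := by rw [← Real.exp_nat_mul]; norm_num
        _ ≤ 2.7182818286 ^ 8 := by gcongr; exact Real.exp_one_lt_d9.le
        _ ≤ 5 ^ 5 := by norm_num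
    have hexp : -1 * ε + 1 * (1 + 1) / 2 * (ε ^ 2 / w) ≤ 1.6 + -(w / 2) := by
      have h1 : ε ^ 2 / w - ε ≤ 1 / w - 1 := by
        rw [← sub_nonneg]
        have : 1 / w - 1 - (ε ^ 2 / w - ε) = (1 - ε) * (1 + ε - w) / w := by
          field_simp
          ring
        rw [this]
        have h2 : 0 ≤ 1 + ε - w := by linarith
        have h3 : 0 ≤ 1 - ε := by linarith
        positivity
      have h2 : 1 / w ≤ 2.6 - w / 2 := by
        rw [div_le_iff₀ hw0]
        nlinarith
      linarith
    calc _ ≤ 1 / 4 * Real.exp (1.6 + -(w / 2)) := by gcongr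
      _ ≤ 5 / 4 * Real.exp (-(w / 2)) := by
        rw [Real.exp_add]
        nlinarith [Real.exp_pos (-(w / 2))]
  · have ht : 1 / 2 ≤ w / ε - 1 / 2 := by
      have : 1 ≤ w / ε := by rw [one_le_div hε0]; linarith
      linarith
    refine ⟨w / ε - 1 / 2, 1 / (1 + (w / ε - 1 / 2)), by linarith, by
      apply one_div_nonneg.2; linarith, exp_le_one_add_inv_mul_exp (by linarith), ?_⟩
    have hK : 1 / (1 + (w / ε - 1 / 2)) ≤ 2 / 3 := by
      rw [div_le_iff₀ (by linarith)]
      linarith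
    have h15 : Real.exp (1 / 2) ≤ 15 / 8 := by
      refine le_of_pow_le_pow_left₀ (n := 2) (by norm_num) (by norm_num) ?_
      rw [← Real.exp_nat_mul]
      norm_num
      linarith [Real.exp_one_lt_d9]
    have hexp : -(w / ε - 1 / 2) * ε +
        (w / ε - 1 / 2) * (1 + (w / ε - 1 / 2)) / 2 * (ε ^ 2 / w) ≤ 1 / 2 + -(w / 2) := by
      have h : -(w / ε - 1 / 2) * ε +
          (w / ε - 1 / 2) * (1 + (w / ε - 1 / 2)) / 2 * (ε ^ 2 / w) =
          ε / 2 - w / 2 - ε ^ 2 / (8 * w) := by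
        field_simp
        ring
      have : 0 ≤ ε ^ 2 / (8 * w) := by positivity
      linarith
    calc _ ≤ 2 / 3 * Real.exp (1 / 2 + -(w / 2)) := by gcongr
      _ ≤ 5 / 4 * Real.exp (-(w / 2)) := by
        rw [Real.exp_add]
        nlinarith [Real.exp_pos (-(w / 2))]

theorem log_five_quarters_gt : 0.22 < Real.log 1.25 := by
  rw [Real.lt_log_iff_exp_lt (by norm_num)]
  refine lt_of_pow_lt_pow_left₀ 50 (by norm_num) ?_
  rw [← Real.exp_nat_mul]
  calc Real.exp ((50 : ℕ) * 0.22) = Real.exp 1 ^ 11 := by rw [← Real.exp_nat_mul]; norm_num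
    _ ≤ 2.7182818286 ^ 11 := by gcongr; exact Real.exp_one_lt_d9.le
    _ < 1.25 ^ 50 := by norm_num

/-- Gaussian mechanism indistinguishability (Dwork–Roth): for `ε, δ ∈ (0,1)`, `Δ > 0`,
`σ ≥ Δ √(2 ln(1.25/δ)) / ε`, and `‖a - b‖₂ ≤ Δ`, the Gaussian measures on `ℝⁿ` with
means `a`, `b` and covariance `σ² I` satisfy `μ_a(S) ≤ e^ε μ_b(S) + δ` for all
measurable `S`. -/
theorem gaussian_mechanism_indistinguishability (n : ℕ)
    (ε δ : ℝ) (hε0 : 0 < ε) (hε1 : ε < 1) (hδ0 : 0 < δ) (hδ1 : δ < 1)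
    (Δ : ℝ) (hΔ : 0 < Δ) (σ : ℝ)
    (hσ : Δ * Real.sqrt (2 * Real.log (1.25 / δ)) / ε ≤ σ)
    (a b : Fin n → ℝ) (hab : Real.sqrt (∑ i : Fin n, (a i - b i) ^ 2) ≤ Δ) :
    ∀ S : Set (Fin n → ℝ), MeasurableSet S →
      (Measure.pi fun i => gaussianReal (a i) (Real.toNNReal (σ ^ 2))) S
        ≤ ENNReal.ofReal (Real.exp ε) *
            (Measure.pi fun i => gaussianReal (b i) (Real.toNNReal (σ ^ 2))) S
          + ENNReal.ofReal δ := by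
  intro S _
  set w := 2 * Real.log (1.25 / δ) with hw
  have hwlb : 0.44 ≤ w := by
    have : Real.log 1.25 ≤ Real.log (1.25 / δ) :=
      Real.log_le_log (by norm_num) (by rw [le_div_iff₀ hδ0]; linarith)
    linarith [log_five_quarters_gt]
  have hw0 : 0 < w := by linarith
  have hσ0 : 0 < σ := lt_of_lt_of_le (by positivity) hσ
  have hδw : 5 / 4 * Real.exp (-(w / 2)) = δ := by
    rw [hw, mul_div_cancel_left₀ _ two_ne_zero, Real.exp_neg, Real.exp_log (by positivity)]
    field_simp
    norm_num
  have hv : Real.toNNReal (σ ^ 2) ≠ 0 := (Real.toNNReal_pos.2 (by positivity)).ne'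
  have hD : (∑ i, (a i - b i) ^ 2) / (Real.toNNReal (σ ^ 2) : ℝ) ≤ ε ^ 2 / w := by
    rw [Real.coe_toNNReal _ (by positivity), div_le_div_iff₀ (by positivity) hw0]
    calc (∑ i, (a i - b i) ^ 2) * w ≤ Δ ^ 2 * w := by
          gcongr
          exact (Real.sqrt_le_left hΔ.le).1 hab
      _ = (Δ * √w) ^ 2 := by rw [mul_pow, Real.sq_sqrt hw0.le]
      _ ≤ (σ * ε) ^ 2 := pow_le_pow_left₀ (by positivity) ((div_le_iff₀ hε0).1 hσ) 2
      _ = ε ^ 2 * σ ^ 2 := by ring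
  obtain ⟨t, K, ht, hK0, hK, hKδ⟩ := exists_chernoff_parameters hε0 hε1 hwlb
  refine (pi_gaussianReal_le_add a b hv ε hK0 hK S).trans ?_
  rw [Measure.add_apply, Measure.smul_apply, Measure.smul_apply, smul_eq_mul, smul_eq_mul]
  gcongr
  refine (mul_le_of_le_one_right' prob_le_one).trans (ENNReal.ofReal_le_ofReal ?_)
  refine le_trans ?_ (hKδ.trans hδw.le)
  gcongr
end
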